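/- arXiv:2302.09712 — 3 statements merged into one kernel-verified Lean document; each statement's English description precedes it below -/
import Mathlib

section
/- For every θ ∈ [0,π], J_{1,1}(θ) = (sin θ + (π − θ) cos θ)/(2π). -/
open MeasureTheory ProbabilityTheory

/-- The standard Gaussian measure on ℝ. -/
noncomputable def stdGaussian : Measure ℝ := gaussianReal 0 1

/-- `Ĝ = G cos θ + W sin θ` built from a pair `p = (G, W)` of independent standard normals. -/
noncomputable def ghat (θ : ℝ) (p : ℝ × ℝ) : ℝ := p.1 * Real.cos θ + p.2 * Real.sin θ

/-- The mixed moment `J_{a,b}(θ) = E[G^a Ĝ^b · 1{G>0} · 1{Ĝ>0}]`, where `G, W` are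
independent standard normals and `Ĝ = G cos θ + W sin θ`. -/
noncomputable def J (a b : ℕ) (θ : ℝ) : ℝ :=
  ∫ p : ℝ × ℝ,
    p.1 ^ a * ghat θ p ^ b * (if 0 < p.1 then (1 : ℝ) else 0) *
      (if 0 < ghat θ p then (1 : ℝ) else 0)
    ∂(stdGaussian.prod stdGaussian)

/-- Two independent standard normals have joint density `exp (-(x² + y²) / 2) / (2π)`. -/
lemma integral_stdGaussian_prod_stdGaussian (f : ℝ × ℝ → ℝ) :
    ∫ p, f p ∂(stdGaussian.prod stdGaussian) =
      ∫ p : ℝ × ℝ, (2 * Real.pi)⁻¹ * Real.exp (-(p.1 ^ 2 + p.2 ^ 2) / 2) * f p := by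
  have hm := measurable_gaussianPDF 0 1
  rw [_root_.stdGaussian, gaussianReal_of_var_ne_zero 0 one_ne_zero, prod_withDensity hm hm,
    integral_withDensity_eq_integral_toReal_smul (by fun_prop)
      (ae_of_all _ fun _ => ENNReal.mul_lt_top gaussianPDF_lt_top gaussianPDF_lt_top)]
  refine integral_congr_ae (ae_of_all _ fun p => ?_)
  have hsqrt : (√(2 * Real.pi))⁻¹ * (√(2 * Real.pi))⁻¹ = (2 * Real.pi)⁻¹ := by
    rw [← mul_inv, Real.mul_self_sqrt (by positivity)]
  simp only [ENNReal.toReal_mul, toReal_gaussianPDF, gaussianPDFReal, sub_zero, NNReal.coe_one,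
    mul_one, smul_eq_mul]
  rw [← hsqrt, neg_add, add_div, Real.exp_add]
  ring

lemma integral_Ioi_pow_three_mul_exp_neg_sq_div_two :
    ∫ r in Set.Ioi (0 : ℝ), r ^ 3 * Real.exp (-r ^ 2 / 2) = 2 := by
  have h := integral_rpow_mul_exp_neg_mul_rpow (p := 2) (q := 3) (b := 1 / 2)
    (by norm_num) (by norm_num) (by norm_num)
  norm_num [Real.Gamma_two] at h
  refine (setIntegral_congr_fun measurableSet_Ioi fun r _ => ?_).trans h
  ring_nf

lemma cos_pos_and_cos_sub_pos_iff {θ α : ℝ} (hθ : θ ∈ Set.Icc 0 Real.pi)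
    (hα : α ∈ Set.Ioo (-Real.pi) Real.pi) :
    (0 < Real.cos α ∧ 0 < Real.cos (α - θ)) ↔
      α ∈ Set.Ioo (θ - Real.pi / 2) (Real.pi / 2) := by
  obtain ⟨hθ0, hθπ⟩ := hθ
  obtain ⟨hα1, hα2⟩ := hα
  constructor
  · rintro ⟨h1, h2⟩
    have hlt : α < Real.pi / 2 := by
      by_contra! h
      exact h1.not_ge (Real.cos_nonpos_of_pi_div_two_le_of_le h (by linarith))
    have hgt : -(Real.pi / 2) < α := by
      by_contra! h
      rw [← Real.cos_neg] at h1
      exact h1.not_ge (Real.cos_nonpos_of_pi_div_two_le_of_le (by linarith) (by linarith))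
    refine ⟨?_, hlt⟩
    by_contra! h
    rw [← Real.cos_neg] at h2
    exact h2.not_ge (Real.cos_nonpos_of_pi_div_two_le_of_le (by linarith) (by linarith))
  · rintro ⟨h1, h2⟩
    exact ⟨Real.cos_pos_of_mem_Ioo ⟨by linarith, h2⟩,
      Real.cos_pos_of_mem_Ioo ⟨by linarith, by linarith⟩⟩

lemma integral_cos_mul_cos_sub (θ : ℝ) :
    ∫ α in (θ - Real.pi / 2)..(Real.pi / 2), Real.cos α * Real.cos (α - θ) =
      (Real.sin θ + (Real.pi - θ) * Real.cos θ) / 2 := by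
  have hderiv (α : ℝ) :
      HasDerivAt (fun x => x * Real.cos θ / 2 + Real.sin (2 * x - θ) / 4)
        (Real.cos α * Real.cos (α - θ)) α := by
    have hlin : HasDerivAt (fun x : ℝ => 2 * x - θ) (2 * 1) α :=
      ((hasDerivAt_id α).const_mul 2).sub_const θ
    have h := (((hasDerivAt_id α).mul_const (Real.cos θ)).div_const 2).add
      (hlin.sin.div_const 4)
    refine h.congr_deriv ?_
    rw [Real.cos_sub, Real.cos_sub, Real.cos_two_mul, Real.sin_two_mul]
    ring
  rw [intervalIntegral.integral_eq_sub_of_hasDerivAt (fun α _ => hderiv α)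
    (by apply Continuous.intervalIntegrable; fun_prop)]
  rw [show 2 * (Real.pi / 2) - θ = Real.pi - θ by ring,
    show 2 * (θ - Real.pi / 2) - θ = θ - Real.pi by ring, Real.sin_pi_sub, Real.sin_sub_pi]
  ring

lemma setIntegral_cos_mul_cos_sub_mul_ite {θ : ℝ} (hθ : θ ∈ Set.Icc 0 Real.pi) :
    ∫ α in Set.Ioo (-Real.pi) Real.pi,
      Real.cos α * Real.cos (α - θ) * (if 0 < Real.cos α then (1 : ℝ) else 0) *
        (if 0 < Real.cos (α - θ) then (1 : ℝ) else 0) =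
      (Real.sin θ + (Real.pi - θ) * Real.cos θ) / 2 := by
  have hπ := Real.pi_pos
  have hcongr : ∀ α ∈ Set.Ioo (-Real.pi) Real.pi,
      Real.cos α * Real.cos (α - θ) * (if 0 < Real.cos α then (1 : ℝ) else 0) *
        (if 0 < Real.cos (α - θ) then (1 : ℝ) else 0) =
      (Set.Ioo (θ - Real.pi / 2) (Real.pi / 2)).indicator
        (fun x => Real.cos x * Real.cos (x - θ)) α := by
    intro α hα
    simp only [Set.indicator_apply, ← cos_pos_and_cos_sub_pos_iff hθ hα, ite_and]
    split_ifs <;> simp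
  have hsub : Set.Ioo (θ - Real.pi / 2) (Real.pi / 2) ⊆ Set.Ioo (-Real.pi) Real.pi :=
    Set.Ioo_subset_Ioo (by linarith [hθ.1]) (by linarith)
  rw [setIntegral_congr_fun measurableSet_Ioo hcongr, setIntegral_indicator measurableSet_Ioo,
    Set.inter_eq_self_of_subset_right hsub, ← integral_Ioc_eq_integral_Ioo,
    ← intervalIntegral.integral_of_le (by linarith [hθ.2]), integral_cos_mul_cos_sub]

/-- `J_{1,1}(θ) = (sin θ + (π − θ) cos θ)/(2π)` for all `θ ∈ [0, π]`. -/
theorem J_one_one (θ : ℝ) (hθ : θ ∈ Set.Icc 0 Real.pi) :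
    J 1 1 θ = (Real.sin θ + (Real.pi - θ) * Real.cos θ) / (2 * Real.pi) := by
  rw [J, integral_stdGaussian_prod_stdGaussian, ← integral_comp_polarCoord_symm,
    polarCoord_target]
  have hcongr : ∀ p ∈ Set.Ioi (0 : ℝ) ×ˢ Set.Ioo (-Real.pi) Real.pi,
      p.1 • ((2 * Real.pi)⁻¹ *
          Real.exp (-((polarCoord.symm p).1 ^ 2 + (polarCoord.symm p).2 ^ 2) / 2) *
        ((polarCoord.symm p).1 ^ 1 * ghat θ (polarCoord.symm p) ^ 1 *
          (if 0 < (polarCoord.symm p).1 then (1 : ℝ) else 0) *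
          (if 0 < ghat θ (polarCoord.symm p) then (1 : ℝ) else 0))) =
      ((2 * Real.pi)⁻¹ * (p.1 ^ 3 * Real.exp (-p.1 ^ 2 / 2))) *
        (Real.cos p.2 * Real.cos (p.2 - θ) * (if 0 < Real.cos p.2 then (1 : ℝ) else 0) *
          (if 0 < Real.cos (p.2 - θ) then (1 : ℝ) else 0)) := by
    rintro ⟨r, α⟩ ⟨hr, -⟩
    replace hr : 0 < r := hr
    have hghat : ghat θ (r * Real.cos α, r * Real.sin α) = r * Real.cos (α - θ) := by
      rw [ghat, Real.cos_sub]
      ring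
    have hnorm : (r * Real.cos α) ^ 2 + (r * Real.sin α) ^ 2 = r ^ 2 := by
      linear_combination r ^ 2 * Real.sin_sq_add_cos_sq α
    simp only [polarCoord_symm_apply, hghat, hnorm, mul_pos_iff_of_pos_left hr, smul_eq_mul]
    ring
  rw [setIntegral_congr_fun (measurableSet_Ioi.prod measurableSet_Ioo) hcongr,
    Measure.volume_eq_prod,
    setIntegral_prod_mul (fun r : ℝ => (2 * Real.pi)⁻¹ * (r ^ 3 * Real.exp (-r ^ 2 / 2)))
      (fun α : ℝ => Real.cos α * Real.cos (α - θ) * (if 0 < Real.cos α then (1 : ℝ) else 0) *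
        (if 0 < Real.cos (α - θ) then (1 : ℝ) else 0)),
    integral_const_mul, integral_Ioi_pow_three_mul_exp_neg_sq_div_two,
    setIntegral_cos_mul_cos_sub_mul_ite hθ]
  field_simp
end

section
/- For all integers a ≥ 2 and b ≥ 1 and every θ ∈ [0,π], J_{a,b}(θ) = (a−1)·J_{a−2,b}(θ) + b cos θ · J_{a−1,b−1}(θ). -/
open MeasureTheory ProbabilityTheory

lemma integrable_abs_pow_stdGaussian (n : ℕ) :
    Integrable (fun x : ℝ => |x| ^ n) stdGaussian := by
  have h := (memLp_id_gaussianReal (μ := 0) (v := 1) (n : NNReal)).integrable_norm_pow'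
  simpa [_root_.stdGaussian] using h

lemma measurable_ghat (θ : ℝ) : Measurable (ghat θ) := by
  unfold ghat
  fun_prop

lemma abs_ghat_le (θ : ℝ) (p : ℝ × ℝ) : |ghat θ p| ≤ |p.1| + |p.2| := by
  unfold ghat
  refine (abs_add_le _ _).trans ?_
  rw [abs_mul, abs_mul]
  exact add_le_add (mul_le_of_le_one_right (abs_nonneg _) (Real.abs_cos_le_one θ))
    (mul_le_of_le_one_right (abs_nonneg _) (Real.abs_sin_le_one θ))

instance : IsProbabilityMeasure stdGaussian := by
  unfold _root_.stdGaussian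
  infer_instance

lemma integrable_J_integrand (a b : ℕ) (θ : ℝ) :
    Integrable (fun p : ℝ × ℝ => p.1 ^ a * ghat θ p ^ b * (if 0 < p.1 then (1 : ℝ) else 0) *
      (if 0 < ghat θ p then (1 : ℝ) else 0)) (stdGaussian.prod stdGaussian) := by
  have hbound : Integrable (fun p : ℝ × ℝ =>
      2 ^ (b - 1) * (|p.1| ^ (a + b) * |p.2| ^ 0 + |p.1| ^ a * |p.2| ^ b))
      (stdGaussian.prod stdGaussian) :=
    (((integrable_abs_pow_stdGaussian (a + b)).mul_prod (integrable_abs_pow_stdGaussian 0)).add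
      ((integrable_abs_pow_stdGaussian a).mul_prod (integrable_abs_pow_stdGaussian b))).const_mul _
  have hg := measurable_ghat θ
  refine hbound.mono' (Measurable.aestronglyMeasurable ?_) (.of_forall fun p => ?_)
  · exact (((measurable_fst.pow_const a).mul (hg.pow_const b)).mul
      (Measurable.ite (measurableSet_lt measurable_const measurable_fst)
        measurable_const measurable_const)).mul
      (Measurable.ite (measurableSet_lt measurable_const hg) measurable_const measurable_const)
  · have hle : |p.1| ^ a * |ghat θ p| ^ b ≤
        2 ^ (b - 1) * (|p.1| ^ (a + b) * |p.2| ^ 0 + |p.1| ^ a * |p.2| ^ b) := calc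
      _ ≤ |p.1| ^ a * (|p.1| + |p.2|) ^ b := by gcongr; exact abs_ghat_le θ p
      _ ≤ |p.1| ^ a * (2 ^ (b - 1) * (|p.1| ^ b + |p.2| ^ b)) := by
        gcongr; exact add_pow_le (abs_nonneg _) (abs_nonneg _) b
      _ = _ := by ring
    refine le_trans ?_ hle
    rw [Real.norm_eq_abs, abs_mul, abs_mul, abs_mul, abs_pow, abs_pow, mul_assoc]
    refine mul_le_of_le_one_right (by positivity) ?_
    split_ifs <;> simp

lemma hasDerivAt_max_zero_pow (n : ℕ) {x : ℝ} (hx : x ≠ 0) :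
    HasDerivAt (fun y : ℝ => max y 0 ^ (n + 1))
      ((n + 1) * x ^ n * (if 0 < x then (1 : ℝ) else 0)) x := by
  rcases hx.lt_or_gt with h | h
  · rw [if_neg h.not_gt, mul_zero]
    refine (hasDerivAt_const x (0 : ℝ)).congr_of_eventuallyEq ?_
    filter_upwards [eventually_lt_nhds h] with y hy
    simp [max_eq_right hy.le]
  · rw [if_pos h, mul_one]
    have hd : HasDerivAt (fun y : ℝ => y ^ (n + 1)) ((n + 1) * x ^ n) x := by
      simpa using hasDerivAt_pow (n + 1) x
    refine hd.congr_of_eventuallyEq ?_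
    filter_upwards [eventually_gt_nhds h] with y hy
    simp [max_eq_left hy.le]

lemma max_zero_pow_succ (n : ℕ) (x : ℝ) :
    max x 0 ^ (n + 1) = x ^ (n + 1) * (if 0 < x then (1 : ℝ) else 0) := by
  split_ifs with h
  · simp [max_eq_left h.le]
  · simp [max_eq_right (not_lt.mp h)]

lemma hasDerivAt_max_affine_pow (n : ℕ) (c d : ℝ) {x : ℝ} (hx : x ≠ -d / c) :
    HasDerivAt (fun y : ℝ => max (c * y + d) 0 ^ (n + 1))
      ((n + 1) * c * (c * x + d) ^ n * (if 0 < c * x + d then (1 : ℝ) else 0)) x := by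
  rcases eq_or_ne c 0 with rfl | hc
  · simpa using hasDerivAt_const x (max d 0 ^ (n + 1))
  · have hne : c * x + d ≠ 0 := fun h => hx (by field_simp; linarith)
    have haff : HasDerivAt (fun y : ℝ => c * y + d) c x := by
      simpa using ((hasDerivAt_id x).const_mul c).add_const d
    exact (HasDerivAt.comp x (hasDerivAt_max_zero_pow n hne) haff).congr_deriv (by ring)

lemma hasDerivAt_gaussianPDFReal_std (x : ℝ) :
    HasDerivAt (gaussianPDFReal 0 1) (-x * gaussianPDFReal 0 1 x) x := by
  have h : HasDerivAt (fun y : ℝ => -y ^ 2 / 2) (-x) x :=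
    ((hasDerivAt_pow 2 x).neg.div_const 2).congr_deriv (by norm_num; ring)
  have h2 := h.exp.const_mul (Real.sqrt (2 * Real.pi))⁻¹
  have hfun : gaussianPDFReal 0 1 = fun y : ℝ =>
      (Real.sqrt (2 * Real.pi))⁻¹ * Real.exp (-y ^ 2 / 2) := by
    ext y
    simp [gaussianPDFReal]
  rw [hfun]
  exact h2.congr_deriv (by ring)

open Filter Topology in
lemma tendsto_polynomial_mul_gaussianPDFReal_std (p : Polynomial ℝ) :
    Tendsto (fun x => p.eval x * gaussianPDFReal 0 1 x) atTop (𝓝 0) := by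
  have h := (Polynomial.tendsto_div_exp_atTop p).norm.const_mul (Real.sqrt (2 * Real.pi))⁻¹
  rw [norm_zero, mul_zero] at h
  refine squeeze_zero_norm' ?_ h
  filter_upwards [eventually_ge_atTop 2] with x hx
  rw [norm_mul, norm_div, Real.norm_of_nonneg (gaussianPDFReal_nonneg _ _ _),
    Real.norm_of_nonneg (Real.exp_pos x).le, div_eq_mul_inv, ← Real.exp_neg]
  simp only [gaussianPDFReal, NNReal.coe_one, mul_one, sub_zero]
  have hexp : Real.exp (-x ^ 2 / 2) ≤ Real.exp (-x) := Real.exp_le_exp.mpr (by nlinarith)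
  calc _ ≤ ‖p.eval x‖ * ((Real.sqrt (2 * Real.pi))⁻¹ * Real.exp (-x)) := by gcongr
    _ = _ := by ring

open Filter Topology in
/-- Gaussian integration by parts for the product of two truncated powers. -/
lemma integral_truncated_pow_stdGaussian_eq_zero (m n : ℕ) (c d : ℝ) (D : ℝ → ℝ)
    (hD : ∀ x, D x = ((m + 1) * x ^ m * (c * x + d) ^ (n + 1) +
      (n + 1) * c * x ^ (m + 1) * (c * x + d) ^ n - x ^ (m + 2) * (c * x + d) ^ (n + 1)) *
      ((if 0 < x then (1 : ℝ) else 0) * (if 0 < c * x + d then (1 : ℝ) else 0)))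
    (hint : Integrable D stdGaussian) : ∫ x, D x ∂stdGaussian = 0 := by
  set H : ℝ → ℝ := fun x =>
    max x 0 ^ (m + 1) * max (c * x + d) 0 ^ (n + 1) * gaussianPDFReal 0 1 x with hH
  have hpdf : Continuous (gaussianPDFReal 0 1) :=
    continuous_iff_continuousAt.mpr fun x => (hasDerivAt_gaussianPDFReal_std x).continuousAt
  have hcont : Continuous H := by fun_prop
  have hderiv : ∀ x ∉ ({0, -d / c} : Set ℝ), HasDerivAt H (gaussianPDFReal 0 1 x * D x) x := by
    intro x hx
    simp only [Set.mem_insert_iff, Set.mem_singleton_iff, not_or] at hx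
    refine (((hasDerivAt_max_zero_pow m hx.1).mul (hasDerivAt_max_affine_pow n c d hx.2)).mul
      (hasDerivAt_gaussianPDFReal_std x)).congr_deriv ?_
    simp only [Pi.mul_apply, max_zero_pow_succ, hD]
    split_ifs <;> ring
  have hint' : Integrable (fun x => gaussianPDFReal 0 1 x * D x) := by
    rw [_root_.stdGaussian, gaussianReal_of_var_ne_zero _ one_ne_zero,
      integrable_withDensity_iff_integrable_smul' (measurable_gaussianPDF 0 1)
        (.of_forall fun _ => gaussianPDF_lt_top)] at hint
    simpa [toReal_gaussianPDF] using hint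
  have hlim := intervalIntegral_tendsto_integral hint' tendsto_neg_atTop_atBot tendsto_id
  have hFTC : ∀ R : ℝ, ∫ x in (-R)..R, gaussianPDFReal 0 1 x * D x = H R - H (-R) := fun R =>
    integral_eq_of_hasDerivAt_off_countable H _ (Set.toFinite _).countable hcont.continuousOn
      (fun x hx => hderiv x hx.2) hint'.intervalIntegrable
  have htop : Tendsto H atTop (𝓝 0) := by
    have hp := (tendsto_polynomial_mul_gaussianPDFReal_std
      (Polynomial.X ^ (m + 1) * (Polynomial.C c * Polynomial.X + Polynomial.C d) ^ (n + 1))).norm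
    rw [norm_zero] at hp
    refine squeeze_zero_norm (fun x => ?_) hp
    simp only [hH, max_zero_pow_succ, Polynomial.eval_mul, Polynomial.eval_pow, Polynomial.eval_X,
      Polynomial.eval_add, Polynomial.eval_C]
    split_ifs <;> simp <;> positivity
  have hbot : Tendsto (fun R : ℝ => H (-R)) atTop (𝓝 0) := by
    refine tendsto_const_nhds.congr' ?_
    filter_upwards [eventually_ge_atTop 0] with R hR
    simp [hH, hR]
  have hzero := htop.sub hbot
  rw [sub_zero] at hzero
  rw [_root_.stdGaussian, integral_gaussianReal_eq_integral_smul one_ne_zero]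
  simp only [id, hFTC] at hlim
  simpa using tendsto_nhds_unique hlim hzero

/-- Two-index recurrence: for `a ≥ 2`, `b ≥ 1`,
`J_{a,b}(θ) = (a−1)·J_{a−2,b}(θ) + b cos θ · J_{a−1,b−1}(θ)`. -/
theorem J_recurrence (a b : ℕ) (ha : 2 ≤ a) (hb : 1 ≤ b) (θ : ℝ)
    (hθ : θ ∈ Set.Icc 0 Real.pi) :
    J a b θ = (a - 1 : ℝ) * J (a - 2) b θ + (b : ℝ) * Real.cos θ * J (a - 1) (b - 1) θ := by
  obtain ⟨m, rfl⟩ := Nat.exists_eq_add_of_le' ha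
  obtain ⟨n, rfl⟩ := Nat.exists_eq_add_of_le' hb
  have h₀ := integrable_J_integrand (m + 2) (n + 1) θ
  have h₁ := (integrable_J_integrand m (n + 1) θ).const_mul (m + 1 : ℝ)
  have h₂ := (integrable_J_integrand (m + 1) n θ).const_mul ((n + 1 : ℝ) * Real.cos θ)
  have hint := (h₁.add h₂).sub h₀
  have hzero := integral_prod_symm _ hint
  rw [integral_eq_zero_of_ae (hint.prod_left_ae.mono fun w hw =>
      integral_truncated_pow_stdGaussian_eq_zero m n (Real.cos θ) (w * Real.sin θ) _
        (fun x => ?_) hw),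
    integral_sub' (h₁.add h₂) h₀, integral_add' h₁ h₂, integral_const_mul, integral_const_mul]
    at hzero
  · simp only [J, Nat.add_sub_cancel, show m + 2 - 1 = m + 1 from rfl]
    push_cast
    linear_combination -hzero
  · simp only [Pi.sub_apply, Pi.add_apply, ghat, mul_comm x (Real.cos θ)]
    ring
end

section
/- With R := (4/n²) · Σ_{i=1}^{n} Σ_{j=1}^{n} φ²(G_i) φ²(Ĝ_j) and S := (2/n²) · Σ_{i=1}^{n} Σ_{j=1}^{n} (φ(G_i)φ(Ĝ_j) − φ(G_j)φ(Ĝ_i))², one has Cov(S, R) = (1/n)(16J_{1,1}² − 32J_{1,1}J_{3,1} + 8J_{2,2} + 8) + (1/n²)(32J_{1,1}²J_{2,2} − 40J_{1,1}² + 96J_{1,1}J_{3,1} − 32J_{1,1}J_{3,3} + 16J_{2,2}² − 32J_{2,2} − 32J_{3,1}² + 16J_{4,2} + 10) + (1/n³)(24J_{1,1}² − 32J_{1,1}²J_{2,2} − 64J_{1,1}J_{3,1} + 32J_{1,1}J_{3,3} − 16J_{2,2}² + 24J_{2,2} + 32J_{3,1}² − 16J_{4,2} − 18), where J_{a,b}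 := J_{a,b}(θ). -/
open MeasureTheory ProbabilityTheory

/-- The law of the i.i.d. pairs `(G_i, W_i)`. -/
noncomputable def pairLaw : Measure (ℝ × ℝ) := stdGaussian.prod stdGaussian

/-- The joint law of `n` i.i.d. pairs of independent standard normals. -/
noncomputable def piMeasure (n : ℕ) : Measure (Fin n → ℝ × ℝ) :=
  MeasureTheory.Measure.pi fun _ : Fin n => pairLaw

/-- `R = (4/n²) Σ_{i,j} φ²(G_i) φ²(Ĝ_j)`. -/
noncomputable def Rfun (n : ℕ) (θ : ℝ) (ω : Fin n → ℝ × ℝ) : ℝ :=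
  4 / (n : ℝ) ^ 2 * ∑ i : Fin n, ∑ j : Fin n, max (ω i).1 0 ^ 2 * max (ghat θ (ω j)) 0 ^ 2

/-- `S = (2/n²) Σ_{i,j} (φ(G_i)φ(Ĝ_j) − φ(G_j)φ(Ĝ_i))²`. -/
noncomputable def Sfun (n : ℕ) (θ : ℝ) (ω : Fin n → ℝ × ℝ) : ℝ :=
  2 / (n : ℝ) ^ 2 * ∑ i : Fin n, ∑ j : Fin n,
    (max (ω i).1 0 * max (ghat θ (ω j)) 0 - max (ω j).1 0 * max (ghat θ (ω i)) 0) ^ 2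

/-- For `k ≥ 1`, `E[φ(G)^(2k)]` is half of the Gaussian moment of order `2k`. -/
lemma integral_max_pow_gaussian {k : ℕ} (hk : k ≠ 0) :
    ∫ x, max x 0 ^ (2 * k) ∂gaussianReal 0 1 = ((2 * k - 1).doubleFactorial : ℝ) / 2 := by
  rw [integral_gaussianReal_eq_integral_smul one_ne_zero]
  have h : ∀ x : ℝ, gaussianPDFReal 0 1 x • max x 0 ^ (2 * k) = (Set.Ioi (0 : ℝ)).indicator
      (fun x => (√(2 * Real.pi))⁻¹ *
        (x ^ ((2 * k : ℕ) : ℝ) * Real.exp (-(1 / 2) * x ^ (2 : ℝ)))) x := by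
    intro x
    by_cases hx : 0 < x
    · rw [Set.indicator_of_mem (Set.mem_Ioi.2 hx), max_eq_left hx.le, gaussianPDFReal,
        Real.rpow_natCast, Real.rpow_two, smul_eq_mul]
      have : -(x - 0) ^ 2 / (2 * ((1 : NNReal) : ℝ)) = -(1 / 2) * x ^ 2 := by push_cast; ring
      rw [this]
      push_cast
      ring_nf
    · rw [Set.indicator_of_notMem (by simpa using hx), max_eq_right (not_lt.1 hx)]
      simp [hk]
  simp_rw [h]
  rw [integral_indicator measurableSet_Ioi, integral_const_mul,
    integral_rpow_mul_exp_neg_mul_rpow two_pos (by linarith [(2 * k).cast_nonneg (α := ℝ)])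
      (by norm_num)]
  have h1 : (((2 * k : ℕ) : ℝ) + 1) / 2 = k + 1 / 2 := by push_cast; ring
  have h2 : -(((2 * k : ℕ) : ℝ) + 1) / 2 = -(k + 1 / 2) := by push_cast; ring
  have h3 : ((1 / 2 : ℝ)) ^ (-((k : ℝ) + 1 / 2)) = 2 ^ k * √2 := by
    rw [one_div, Real.inv_rpow two_pos.le, Real.rpow_neg two_pos.le, inv_inv,
      Real.rpow_add two_pos, Real.rpow_natCast, Real.sqrt_eq_rpow, one_div]
  rw [h1, h2, h3, Real.Gamma_nat_add_half, Real.sqrt_mul two_pos.le]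
  have := Real.sqrt_pos.2 Real.pi_pos
  field_simp

/-- The reflection of the plane exchanging `(G, Ĝ)`. -/
noncomputable def planeReflection (θ : ℝ) : ℝ × ℝ →L[ℝ] ℝ × ℝ :=
  (Real.cos θ • ContinuousLinearMap.fst ℝ ℝ ℝ + Real.sin θ • ContinuousLinearMap.snd ℝ ℝ ℝ).prod
    (Real.sin θ • ContinuousLinearMap.fst ℝ ℝ ℝ - Real.cos θ • ContinuousLinearMap.snd ℝ ℝ ℝ)

lemma planeReflection_fst (θ : ℝ) (p : ℝ × ℝ) : (planeReflection θ p).1 = ghat θ p := by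
  simp [planeReflection, ghat, mul_comm]

lemma ghat_planeReflection (θ : ℝ) (p : ℝ × ℝ) : ghat θ (planeReflection θ p) = p.1 := by
  simp only [planeReflection, ghat, ContinuousLinearMap.prod_apply, add_apply,
    sub_apply, smul_apply, ContinuousLinearMap.coe_fst',
    ContinuousLinearMap.coe_snd', smul_eq_mul]
  linear_combination p.1 * Real.sin_sq_add_cos_sq θ

lemma continuous_ghat (θ : ℝ) : Continuous (ghat θ) := by
  unfold ghat
  fun_prop

lemma pairLaw_eq : pairLaw = (gaussianReal 0 1).prod (gaussianReal 0 1) := rfl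

instance : IsProbabilityMeasure pairLaw := by
  rw [pairLaw_eq]
  infer_instance

lemma charFunDual_pairLaw (L : StrongDual ℝ (ℝ × ℝ)) :
    charFunDual pairLaw L = Complex.exp (-(L (1, 0) ^ 2 + L (0, 1) ^ 2) / 2) := by
  rw [pairLaw_eq, charFunDual_prod, charFunDual_eq_charFun_map_one,
    charFunDual_eq_charFun_map_one, gaussianReal_map_continuousLinearMap,
    gaussianReal_map_continuousLinearMap, charFun_gaussianReal, charFun_gaussianReal,
    ← Complex.exp_add]
  congr 1
  have h0 : L (0, 0) = 0 := map_zero L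
  simp [Real.coe_toNNReal _ (sq_nonneg _), h0]
  ring

lemma measurePreserving_planeReflection (θ : ℝ) :
    MeasurePreserving (planeReflection θ) pairLaw pairLaw := by
  have hm := (planeReflection θ).continuous.measurable
  refine ⟨hm, ?_⟩
  have := Measure.isProbabilityMeasure_map (μ := pairLaw) hm.aemeasurable
  refine Measure.ext_of_charFunDual (funext fun L => ?_)
  rw [charFunDual_map, charFunDual_pairLaw, charFunDual_pairLaw]
  have hL : ∀ a b : ℝ, L (a, b) = a * L (1, 0) + b * L (0, 1) := by
    intro a b
    rw [← smul_eq_mul, ← smul_eq_mul, ← map_smul, ← map_smul, ← map_add]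
    simp
  have h1 : (L.comp (planeReflection θ)) (1, 0) = Real.cos θ * L (1, 0) + Real.sin θ * L (0, 1) := by
    rw [← hL]; simp [planeReflection]
  have h2 : (L.comp (planeReflection θ)) (0, 1) = Real.sin θ * L (1, 0) - Real.cos θ * L (0, 1) := by
    rw [sub_eq_add_neg, ← neg_mul, ← hL]; simp [planeReflection]
  rw [h1, h2]
  congr 2
  norm_cast
  linear_combination (-(L (1, 0) ^ 2 + L (0, 1) ^ 2)) * Real.sin_sq_add_cos_sq θ

/-- The mixed moment `E[φ(G)^a φ(Ĝ)^b]`. -/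
noncomputable def reluMoment (θ : ℝ) (a b : ℕ) : ℝ :=
  ∫ p, max p.1 0 ^ a * max (ghat θ p) 0 ^ b ∂pairLaw

lemma reluMoment_comm (θ : ℝ) (a b : ℕ) : reluMoment θ a b = reluMoment θ b a := by
  have hc : Continuous fun p : ℝ × ℝ => max p.1 0 ^ a * max (ghat θ p) 0 ^ b := by
    have := continuous_ghat θ
    fun_prop
  have h := integral_map (μ := pairLaw) (measurePreserving_planeReflection θ).measurable.aemeasurable
    hc.aestronglyMeasurable
  rw [(measurePreserving_planeReflection θ).map_eq] at h
  rw [reluMoment, h, reluMoment]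
  simp only [planeReflection_fst, ghat_planeReflection, mul_comm]

lemma reluMoment_zero_right (θ : ℝ) {k : ℕ} (hk : k ≠ 0) :
    reluMoment θ (2 * k) 0 = ((2 * k - 1).doubleFactorial : ℝ) / 2 := by
  rw [← integral_max_pow_gaussian hk, reluMoment, pairLaw_eq]
  simp only [pow_zero, mul_one]
  simpa using integral_fun_fst (μ := gaussianReal 0 1) (ν := gaussianReal 0 1)
    (fun x : ℝ => max x 0 ^ (2 * k))

lemma J_eq_reluMoment {a b : ℕ} (ha : a ≠ 0) (hb : b ≠ 0) (θ : ℝ) :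
    J a b θ = reluMoment θ a b := by
  have key : ∀ (x : ℝ) {m : ℕ}, m ≠ 0 → max x 0 ^ m = x ^ m * (if 0 < x then (1 : ℝ) else 0) := by
    intro x m hm
    split_ifs with hx
    · rw [max_eq_left hx.le, mul_one]
    · rw [max_eq_right (not_lt.1 hx), zero_pow hm, mul_zero]
  refine integral_congr_ae (.of_forall fun p => ?_)
  simp only [key _ ha, key _ hb]
  ring

lemma integrable_max_fst_pow (k : ℕ) : Integrable (fun p : ℝ × ℝ => max p.1 0 ^ k) pairLaw := by
  have h : Integrable (fun x : ℝ => ‖x‖ ^ k) (gaussianReal 0 1) := by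
    have := (memLp_id_gaussianReal (μ := 0) (v := 1) k).integrable_norm_pow'
    simpa using this
  have hnorm : Integrable (fun p : ℝ × ℝ => ‖p.1‖ ^ k) pairLaw := by
    rw [pairLaw_eq]
    exact h.comp_fst _
  refine hnorm.mono' (by fun_prop) (.of_forall fun p => ?_)
  rw [Real.norm_of_nonneg (by positivity)]
  gcongr
  exact max_le (Real.le_norm_self _) (norm_nonneg _)

lemma integrable_relu (θ : ℝ) (a b : ℕ) :
    Integrable (fun p : ℝ × ℝ => max p.1 0 ^ a * max (ghat θ p) 0 ^ b) pairLaw := by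
  have hg := continuous_ghat θ
  have h2 : Integrable (fun p : ℝ × ℝ => max (ghat θ p) 0 ^ (2 * b)) pairLaw := by
    have := (measurePreserving_planeReflection θ).integrable_comp_of_integrable
      (integrable_max_fst_pow (2 * b))
    simpa only [Function.comp_def, planeReflection_fst] using this
  refine ((integrable_max_fst_pow (2 * a)).add h2).mono'
    (Continuous.aestronglyMeasurable (by fun_prop)) (.of_forall fun p => ?_)
  have hx : 0 ≤ max p.1 0 ^ a := by positivity
  have hy : 0 ≤ max (ghat θ p) 0 ^ b := by positivity
  rw [Real.norm_of_nonneg (by positivity), Pi.add_apply, mul_comm 2 a, mul_comm 2 b, pow_mul,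
    pow_mul]
  nlinarith [sq_nonneg (max p.1 0 ^ a - max (ghat θ p) 0 ^ b)]

lemma integrable_and_integral_prod_sum_succ
    {ι Ω : Type*} [DecidableEq ι] [MeasurableSpace Ω] 
    {μ : Measure Ω} [IsProbabilityMeasure μ]
    {f : ι → Ω → ℝ} (hf : ∀ A : Finset ι, Integrable (fun x => ∏ k ∈ A, f k x) μ) {n : ℕ}
    (hn : ∀ A : Finset ι, Integrable (fun ω : Fin n → Ω => ∏ k ∈ A, ∑ i, f k (ω i))
      (Measure.pi fun _ => μ)) (A : Finset ι) :
    Integrable (fun ω : Fin (n + 1) → Ω => ∏ k ∈ A, ∑ i, f k (ω i)) (Measure.pi fun _ => μ) ∧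
    ∫ ω : Fin (n + 1) → Ω, ∏ k ∈ A, ∑ i, f k (ω i) ∂Measure.pi (fun _ => μ) =
      ∑ B ∈ A.powerset, (∫ x, ∏ k ∈ B, f k x ∂μ) *
        ∫ ω : Fin n → Ω, ∏ k ∈ A \ B, ∑ i, f k (ω i) ∂Measure.pi (fun _ => μ) := by
  have hmp := (measurePreserving_piFinSuccAbove (fun _ : Fin (n + 1) => μ) 0).symm
  have hfun : ∀ z : Ω × (Fin n → Ω),
      ∏ k ∈ A, ∑ i, f k ((MeasurableEquiv.piFinSuccAbove (fun _ => Ω) 0).symm z i) =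
      ∑ B ∈ A.powerset, (∏ k ∈ B, f k z.1) * ∏ k ∈ A \ B, ∑ i, f k (z.2 i) := by
    intro z
    rw [← Finset.prod_add]
    simp [MeasurableEquiv.piFinSuccAbove_symm_apply, Fin.insertNthEquiv, Fin.sum_univ_succ]
  have hint : ∀ B ∈ A.powerset, Integrable (fun z : Ω × (Fin n → Ω) =>
      (∏ k ∈ B, f k z.1) * ∏ k ∈ A \ B, ∑ i, f k (z.2 i)) (μ.prod (Measure.pi fun _ => μ)) :=
    fun B _ => (hf B).mul_prod (hn (A \ B))
  constructor
  · rw [← hmp.integrable_comp_emb (MeasurableEquiv.measurableEmbedding _)]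
    simp only [Function.comp_def, hfun]
    exact integrable_finsetSum _ hint
  · rw [← hmp.integral_comp']
    simp only [hfun]
    rw [integral_finsetSum _ hint]
    exact Finset.sum_congr rfl fun B _ => integral_prod_mul
      (fun x => ∏ k ∈ B, f k x) (fun ω : Fin n → Ω => ∏ k ∈ A \ B, ∑ i, f k (ω i))

lemma integrable_prod_sum {ι Ω : Type*} [DecidableEq ι] [MeasurableSpace Ω] 
    {μ : Measure Ω} [IsProbabilityMeasure μ] {f : ι → Ω → ℝ}
    (hf : ∀ A : Finset ι, Integrable (fun x => ∏ k ∈ A, f k x) μ) (n : ℕ) (A : Finset ι) :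
    Integrable (fun ω : Fin n → Ω => ∏ k ∈ A, ∑ i, f k (ω i)) (Measure.pi fun _ => μ) := by
  induction n generalizing A with
  | zero => exact Integrable.of_finite
  | succ n ih => exact (integrable_and_integral_prod_sum_succ hf ih A).1

/-- The moments `m` of one family of variables, and the moments `U n` of its sum over `n`
independent copies, both indexed by the set of factors. -/
structure IsPowerSumMoment {ι : Type*} [DecidableEq ι] (m : Finset ι → ℝ)
    (U : ℕ → Finset ι → ℝ) : Prop where
  empty : m ∅ = 1
  zero : ∀ A, U 0 A = if A = ∅ then 1 else 0
  succ : ∀ n A, U (n + 1) A = ∑ B ∈ A.powerset, m B * U n (A \ B)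

lemma isPowerSumMoment_integral {ι Ω : Type*} [DecidableEq ι] [MeasurableSpace Ω] 
    {μ : Measure Ω} [IsProbabilityMeasure μ] {f : ι → Ω → ℝ}
    (hf : ∀ A : Finset ι, Integrable (fun x => ∏ k ∈ A, f k x) μ) :
    IsPowerSumMoment (fun A => ∫ x, ∏ k ∈ A, f k x ∂μ)
      (fun n A => ∫ ω : Fin n → Ω, ∏ k ∈ A, ∑ i, f k (ω i) ∂Measure.pi (fun _ => μ)) where
  empty := by simp
  zero A := by
    simp only [Finset.univ_eq_empty, Finset.sum_empty, integral_const, probReal_univ, one_smul,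
      Finset.prod_const]
    split_ifs with h
    · simp [h]
    · exact zero_pow (Finset.card_ne_zero.2 (Finset.nonempty_iff_ne_empty.2 h))
  succ n A := (integrable_and_integral_prod_sum_succ hf (integrable_prod_sum hf n) A).2

namespace IsPowerSumMoment

variable {ι : Type*} [DecidableEq ι] {m : Finset ι → ℝ} {U : ℕ → Finset ι → ℝ}

lemma empty_right (h : IsPowerSumMoment m U) (n : ℕ) : U n ∅ = 1 := by
  induction n with
  | zero => simp [h.zero]
  | succ n ih => simp [h.succ, h.empty, ih]

lemma singleton (h : IsPowerSumMoment m U) (n : ℕ) (i : ι) : U n {i} = n * m {i} := by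
  induction n with
  | zero => simp [h.zero]
  | succ n ih =>
    rw [h.succ, ← insert_empty_eq, Finset.sum_powerset_insert (by simp)]
    simp only [Finset.powerset_empty, Finset.sum_singleton, insert_empty_eq, Finset.sdiff_empty,
      sdiff_self, Finset.bot_eq_empty, h.empty, h.empty_right, ih]
    push_cast
    ring

lemma pair (h : IsPowerSumMoment m U) (n : ℕ) {i j : ι} (hij : i ≠ j) :
    U n {i, j} = n * m {i, j} + n * (n - 1) * (m {i} * m {j}) := by
  induction n with
  | zero => simp [h.zero]
  | succ n ih =>
    rw [h.succ, ← insert_empty_eq j, Finset.sum_powerset_insert (by simpa),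
      Finset.sum_powerset_insert (by simp), Finset.sum_powerset_insert (by simp)]
    simp only [Finset.powerset_empty, Finset.sum_singleton, insert_empty_eq, Finset.sdiff_empty,
      sdiff_self, Finset.bot_eq_empty, h.empty]
    rw [show ({i, j} : Finset ι) \ {j} = {i} by grind, show ({i, j} : Finset ι) \ {i} = {j} by grind]
    simp only [h.singleton, h.empty_right, ih]
    push_cast
    ring

lemma triple (h : IsPowerSumMoment m U) (n : ℕ) {i j k : ι} (hij : i ≠ j) (hik : i ≠ k)
    (hjk : j ≠ k) :
    U n {i, j, k} = n * m {i, j, k}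
      + n * (n - 1) * (m {i} * m {j, k} + m {j} * m {i, k} + m {k} * m {i, j})
      + n * (n - 1) * (n - 2) * (m {i} * m {j} * m {k}) := by
  induction n with
  | zero => simp [h.zero]
  | succ n ih =>
    rw [h.succ, ← insert_empty_eq k]
    repeat rw [Finset.sum_powerset_insert (by simp [*])]
    simp only [Finset.powerset_empty, Finset.sum_singleton, insert_empty_eq, Finset.sdiff_empty,
      sdiff_self, Finset.bot_eq_empty, h.empty]
    rw [show ({i, j, k} : Finset ι) \ {k} = {i, j} by grind,
      show ({i, j, k} : Finset ι) \ {j} = {i, k} by grind,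
      show ({i, j, k} : Finset ι) \ {i} = {j, k} by grind,
      show ({i, j, k} : Finset ι) \ {j, k} = {i} by grind,
      show ({i, j, k} : Finset ι) \ {i, k} = {j} by grind,
      show ({i, j, k} : Finset ι) \ {i, j} = {k} by grind]
    simp only [h.singleton, h.empty_right, h.pair _ hij, h.pair _ hik, h.pair _ hjk, ih]
    push_cast
    ring

lemma quadruple (h : IsPowerSumMoment m U) (n : ℕ) {i j k l : ι} (hij : i ≠ j) (hik : i ≠ k)
    (hil : i ≠ l) (hjk : j ≠ k) (hjl : j ≠ l) (hkl : k ≠ l) :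
    U n {i, j, k, l} = n * m {i, j, k, l}
      + n * (n - 1) * (m {i} * m {j, k, l} + m {j} * m {i, k, l} + m {k} * m {i, j, l}
        + m {l} * m {i, j, k} + m {i, j} * m {k, l} + m {i, k} * m {j, l} + m {i, l} * m {j, k})
      + n * (n - 1) * (n - 2) * (m {i} * m {j} * m {k, l} + m {i} * m {k} * m {j, l}
        + m {i} * m {l} * m {j, k} + m {j} * m {k} * m {i, l} + m {j} * m {l} * m {i, k}
        + m {k} * m {l} * m {i, j})
      + n * (n - 1) * (n - 2) * (n - 3) * (m {i} * m {j} * m {k} * m {l}) := by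
  induction n with
  | zero => simp [h.zero]
  | succ n ih =>
    rw [h.succ, ← insert_empty_eq l]
    repeat rw [Finset.sum_powerset_insert (by simp [*])]
    simp only [Finset.powerset_empty, Finset.sum_singleton, insert_empty_eq, Finset.sdiff_empty,
      sdiff_self, Finset.bot_eq_empty, h.empty]
    rw [show ({i, j, k, l} : Finset ι) \ {l} = {i, j, k} by grind,
      show ({i, j, k, l} : Finset ι) \ {k} = {i, j, l} by grind,
      show ({i, j, k, l} : Finset ι) \ {j} = {i, k, l} by grind,
      show ({i, j, k, l} : Finset ι) \ {i} = {j, k, l} by grind,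
      show ({i, j, k, l} : Finset ι) \ {k, l} = {i, j} by grind,
      show ({i, j, k, l} : Finset ι) \ {j, l} = {i, k} by grind,
      show ({i, j, k, l} : Finset ι) \ {j, k} = {i, l} by grind,
      show ({i, j, k, l} : Finset ι) \ {i, l} = {j, k} by grind,
      show ({i, j, k, l} : Finset ι) \ {i, k} = {j, l} by grind,
      show ({i, j, k, l} : Finset ι) \ {i, j} = {k, l} by grind,
      show ({i, j, k, l} : Finset ι) \ {j, k, l} = {i} by grind,
      show ({i, j, k, l} : Finset ι) \ {i, k, l} = {j} by grind,
      show ({i, j, k, l} : Finset ι) \ {i, j, l} = {k} by grind,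
      show ({i, j, k, l} : Finset ι) \ {i, j, k} = {l} by grind]
    simp only [h.singleton, h.empty_right, h.pair _ hij, h.pair _ hik, h.pair _ hil, h.pair _ hjk,
      h.pair _ hjl, h.pair _ hkl, h.triple _ hij hik hjk, h.triple _ hij hil hjl,
      h.triple _ hik hil hkl, h.triple _ hjk hjl hkl, ih]
    push_cast
    ring

end IsPowerSumMoment

/-- The power sum `Σ_i φ(G_i)^a φ(Ĝ_i)^b`. -/
noncomputable def reluPowerSum (n : ℕ) (θ : ℝ) (a b : ℕ) (ω : Fin n → ℝ × ℝ) : ℝ :=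
  ∑ i, max (ω i).1 0 ^ a * max (ghat θ (ω i)) 0 ^ b

lemma prod_relu_eq {ι : Type*} (θ : ℝ) (a b : ι → ℕ) (A : Finset ι) (p : ℝ × ℝ) :
    ∏ k ∈ A, (max p.1 0 ^ a k * max (ghat θ p) 0 ^ b k) =
      max p.1 0 ^ (∑ k ∈ A, a k) * max (ghat θ p) 0 ^ (∑ k ∈ A, b k) := by
  rw [Finset.prod_mul_distrib, Finset.prod_pow_eq_pow_sum, Finset.prod_pow_eq_pow_sum]

lemma integrable_prod_relu {ι : Type*} (θ : ℝ) (a b : ι → ℕ) (A : Finset ι) :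
    Integrable (fun p : ℝ × ℝ => ∏ k ∈ A, (max p.1 0 ^ a k * max (ghat θ p) 0 ^ b k)) pairLaw := by
  simp only [prod_relu_eq]
  exact integrable_relu θ _ _

lemma integrable_prod_reluPowerSum {ι : Type*} [DecidableEq ι] (n : ℕ) (θ : ℝ) (a b : ι → ℕ)
    (A : Finset ι) :
    Integrable (fun ω => ∏ k ∈ A, reluPowerSum n θ (a k) (b k) ω) (piMeasure n) :=
  integrable_prod_sum (integrable_prod_relu θ a b) n A

lemma isPowerSumMoment_relu {ι : Type*} [DecidableEq ι] (θ : ℝ) (a b : ι → ℕ) :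
    IsPowerSumMoment (fun A => reluMoment θ (∑ k ∈ A, a k) (∑ k ∈ A, b k))
      (fun n A => ∫ ω, ∏ k ∈ A, reluPowerSum n θ (a k) (b k) ω ∂piMeasure n) := by
  have h := isPowerSumMoment_integral (integrable_prod_relu θ a b)
  simp only [prod_relu_eq] at h
  exact h

lemma Rfun_eq (n : ℕ) (θ : ℝ) (ω : Fin n → ℝ × ℝ) :
    Rfun n θ ω = 4 / (n : ℝ) ^ 2 * (reluPowerSum n θ 2 0 ω * reluPowerSum n θ 0 2 ω) := by
  simp only [Rfun, reluPowerSum, pow_zero, mul_one, one_mul, Finset.sum_mul_sum]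

lemma Sfun_eq (n : ℕ) (θ : ℝ) (ω : Fin n → ℝ × ℝ) :
    Sfun n θ ω = 4 / (n : ℝ) ^ 2 * (reluPowerSum n θ 2 0 ω * reluPowerSum n θ 0 2 ω -
      reluPowerSum n θ 1 1 ω * reluPowerSum n θ 1 1 ω) := by
  have h : ∑ i : Fin n, ∑ j : Fin n,
      (max (ω i).1 0 * max (ghat θ (ω j)) 0 - max (ω j).1 0 * max (ghat θ (ω i)) 0) ^ 2 =
      reluPowerSum n θ 2 0 ω * reluPowerSum n θ 0 2 ω +
      reluPowerSum n θ 0 2 ω * reluPowerSum n θ 2 0 ω -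
      2 * (reluPowerSum n θ 1 1 ω * reluPowerSum n θ 1 1 ω) := by
    simp only [reluPowerSum, Finset.sum_mul_sum]
    simp only [Finset.mul_sum, ← Finset.sum_add_distrib,
      ← Finset.sum_sub_distrib]
    refine Finset.sum_congr rfl fun i _ => Finset.sum_congr rfl fun j _ => ?_
    ring
  rw [Sfun, h]
  ring

lemma integral_sub_mul_sub {Ω : Type*} [MeasurableSpace Ω] {μ : Measure Ω}
    [IsProbabilityMeasure μ] {X Y : Ω → ℝ} (hX : Integrable X μ) (hY : Integrable Y μ)
    (hXY : Integrable (fun ω => X ω * Y ω) μ) :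
    ∫ ω, (X ω - ∫ ω', X ω' ∂μ) * (Y ω - ∫ ω', Y ω' ∂μ) ∂μ =
      ∫ ω, X ω * Y ω ∂μ - (∫ ω, X ω ∂μ) * ∫ ω, Y ω ∂μ := by
  set x := ∫ ω, X ω ∂μ with hx
  set y := ∫ ω, Y ω ∂μ with hy
  have h : ∀ ω, (X ω - x) * (Y ω - y) = X ω * Y ω - y * X ω - x * Y ω + x * y := by
    intro ω; ring
  simp_rw [h]
  have h1 : Integrable (fun ω => X ω * Y ω - y * X ω) μ := hXY.sub (hX.const_mul y)
  have h2 : Integrable (fun ω => X ω * Y ω - y * X ω - x * Y ω) μ := h1.sub (hY.const_mul x)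
  rw [integral_add h2 (integrable_const _), integral_sub h1 (hY.const_mul x),
    integral_sub hXY (hX.const_mul y), integral_const_mul, integral_const_mul, ← hx, ← hy]
  simp
  ring

instance (n : ℕ) : IsProbabilityMeasure (piMeasure n) := by
  unfold piMeasure
  infer_instance

/-- Exact formula for `Cov(S, R)` in terms of the mixed moments `J_{a,b}(θ)`. -/
theorem covariance_S_R (n : ℕ) (hn : 1 ≤ n) (θ : ℝ) (hθ : θ ∈ Set.Icc 0 Real.pi) :
    (∫ ω, (Sfun n θ ω - ∫ ω', Sfun n θ ω' ∂piMeasure n)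
        * (Rfun n θ ω - ∫ ω', Rfun n θ ω' ∂piMeasure n) ∂piMeasure n) =
      1 / n * (16 * J 1 1 θ ^ 2 - 32 * J 1 1 θ * J 3 1 θ + 8 * J 2 2 θ + 8)
      + 1 / (n : ℝ) ^ 2 *
          (32 * J 1 1 θ ^ 2 * J 2 2 θ - 40 * J 1 1 θ ^ 2 + 96 * J 1 1 θ * J 3 1 θ
            - 32 * J 1 1 θ * J 3 3 θ + 16 * J 2 2 θ ^ 2 - 32 * J 2 2 θ
            - 32 * J 3 1 θ ^ 2 + 16 * J 4 2 θ + 10)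
      + 1 / (n : ℝ) ^ 3 *
          (24 * J 1 1 θ ^ 2 - 32 * J 1 1 θ ^ 2 * J 2 2 θ - 64 * J 1 1 θ * J 3 1 θ
            + 32 * J 1 1 θ * J 3 3 θ - 16 * J 2 2 θ ^ 2 + 24 * J 2 2 θ
            + 32 * J 3 1 θ ^ 2 - 16 * J 4 2 θ - 18) := by
  set A := reluPowerSum n θ 2 0 with hA
  set B := reluPowerSum n θ 0 2 with hB
  set C := reluPowerSum n θ 1 1 with hC
  have hn0 : (n : ℝ) ≠ 0 := by positivity
  let u : Fin 4 → ℕ := ![2, 0, 2, 0]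
  let v : Fin 4 → ℕ := ![0, 2, 0, 2]
  let r : Fin 4 → ℕ := ![2, 0, 1, 1]
  let s : Fin 4 → ℕ := ![0, 2, 1, 1]
  have iAB : Integrable (fun ω => A ω * B ω) (piMeasure n) := by
    simpa [r, s] using integrable_prod_reluPowerSum n θ r s {0, 1}
  have iCC : Integrable (fun ω => C ω * C ω) (piMeasure n) := by
    simpa [r, s] using integrable_prod_reluPowerSum n θ r s {2, 3}
  have iABAB : Integrable (fun ω => A ω * (B ω * (A ω * B ω))) (piMeasure n) := by
    simpa [u, v] using integrable_prod_reluPowerSum n θ u v {0, 1, 2, 3}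
  have iABCC : Integrable (fun ω => A ω * (B ω * (C ω * C ω))) (piMeasure n) := by
    simpa [r, s] using integrable_prod_reluPowerSum n θ r s {0, 1, 2, 3}
  have h20 : reluMoment θ 2 0 = 1 / 2 := by
    simpa using reluMoment_zero_right θ (k := 1) one_ne_zero
  have h40 : reluMoment θ 4 0 = 3 / 2 := by
    simpa [Nat.doubleFactorial] using reluMoment_zero_right θ (k := 2) two_ne_zero
  have h02 : reluMoment θ 0 2 = 1 / 2 := by rw [reluMoment_comm, h20]
  have h04 : reluMoment θ 0 4 = 3 / 2 := by rw [reluMoment_comm, h40]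
  have h13 : reluMoment θ 1 3 = reluMoment θ 3 1 := reluMoment_comm ..
  have h24 : reluMoment θ 2 4 = reluMoment θ 4 2 := reluMoment_comm ..
  have eAB : ∫ ω, A ω * B ω ∂piMeasure n =
      n * reluMoment θ 2 2 + n * (n - 1) * (1 / 2 * (1 / 2)) := by
    simpa [r, s, h20, h02] using
      (isPowerSumMoment_relu θ r s).pair n (show (0 : Fin 4) ≠ 1 by decide)
  have eCC : ∫ ω, C ω * C ω ∂piMeasure n =
      n * reluMoment θ 2 2 + n * (n - 1) * (reluMoment θ 1 1 * reluMoment θ 1 1) := by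
    simpa [r, s] using
      (isPowerSumMoment_relu θ r s).pair n (show (2 : Fin 4) ≠ 3 by decide)
  have eABAB := (isPowerSumMoment_relu θ u v).quadruple n (i := 0) (j := 1) (k := 2) (l := 3)
    (by decide) (by decide) (by decide) (by decide) (by decide) (by decide)
  have eABCC := (isPowerSumMoment_relu θ r s).quadruple n (i := 0) (j := 1) (k := 2) (l := 3)
    (by decide) (by decide) (by decide) (by decide) (by decide) (by decide)
  simp [u, v, h20, h02, h40, h04, h24, ← hA, ← hB] at eABAB
  simp [r, s, h20, h02, h13, h24, ← hA, ← hB, ← hC] at eABCC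
  have iR : Integrable (Rfun n θ) (piMeasure n) := by
    simp only [funext (Rfun_eq n θ)]
    exact iAB.const_mul _
  have iS : Integrable (Sfun n θ) (piMeasure n) := by
    simp only [funext (Sfun_eq n θ)]
    exact (iAB.sub iCC).const_mul _
  have hSR : ∀ ω, Sfun n θ ω * Rfun n θ ω = 16 / (n : ℝ) ^ 4 *
      (A ω * (B ω * (A ω * B ω)) - A ω * (B ω * (C ω * C ω))) := by
    intro ω
    rw [Sfun_eq, Rfun_eq]
    ring
  have iSR : Integrable (fun ω => Sfun n θ ω * Rfun n θ ω) (piMeasure n) := by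
    simp only [hSR]
    exact (iABAB.sub iABCC).const_mul _
  rw [integral_sub_mul_sub iS iR iSR]
  simp_rw [hSR]
  simp only [Sfun_eq, Rfun_eq, ← hA, ← hB, ← hC]
  rw [integral_const_mul, integral_const_mul, integral_const_mul, integral_sub iABAB iABCC,
    integral_sub iAB iCC, eAB, eCC]
  rw [J_eq_reluMoment one_ne_zero one_ne_zero, J_eq_reluMoment three_ne_zero one_ne_zero,
    J_eq_reluMoment two_ne_zero two_ne_zero, J_eq_reluMoment three_ne_zero three_ne_zero,
    J_eq_reluMoment four_ne_zero two_ne_zero]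
  rw [eABAB, eABCC]
  field_simp
  ring
end
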